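/- Let R be a commutative ring which is an ℝ-algebra, let n₁, n₂ ≥ 1 be integers, n = n₁ + n₂ + 1, and let a, b, t be real numbers. Suppose φ₁, φ₂, η ∈ R satisfy φ₁^{n₁+1} = 0, φ₂^{n₂+1} = 0 and η² = 0. Then (φ₁² + (2a)•(φ₁·φ₂) + (a²+b²)•φ₂²)·(φ₁ + φ₂ + t•η)^{n-2} = ((n-2)·t·C(n,n₂)) • (φ₁^{n₁}·φ₂^{n₂}·η), where C(n,n₂) = C(n-3, n₂) + 2a·C(n-3, n₂-1) + (a²+b²)·C(n-3, n₂-2), binomial coefficients being taken to vanish when the lower index is negative. -/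

import Mathlib

/-- Binomial coefficient `C(m, k)` cast to `ℝ`, with the convention that it
vanishes when the lower index `k` is negative. -/
noncomputable def rchoose (m : ℕ) (k : ℤ) : ℝ :=
  if 0 ≤ k then (m.choose k.toNat : ℝ) else 0

theorem rchoose_zero (k : ℤ) : rchoose 0 k = if k = 0 then 1 else 0 := by
  rcases lt_trichotomy k 0 with hk | rfl | hk
  · simp [rchoose, hk.not_ge, hk.ne]
  · simp [rchoose]
  · obtain ⟨l, rfl⟩ : ∃ l : ℕ, k = l + 1 := ⟨(k - 1).toNat, by omega⟩
    have hl : ((l : ℤ) + 1).toNat = l + 1 := by omega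
    simp [rchoose, hk.le, hk.ne', hl]

theorem rchoose_succ (m : ℕ) (k : ℤ) :
    rchoose (m + 1) k = rchoose m k + rchoose m (k - 1) := by
  rcases lt_trichotomy k 0 with hk | rfl | hk
  · have hk' : ¬ 0 ≤ k - 1 := by omega
    simp only [rchoose, hk.not_ge, hk', if_false, add_zero]
  · simp [rchoose]
  · obtain ⟨l, rfl⟩ : ∃ l : ℕ, k = l + 1 := ⟨(k - 1).toNat, by omega⟩
    have hl : ((l : ℤ) + 1).toNat = l + 1 := by omega
    simp [rchoose, hk.le, hl, Nat.choose_succ_succ, add_comm]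

theorem pow_mul_pow_mul_add_pow_eq_zero {R : Type*} [CommRing R] {x y : R} {p q : ℕ}
    (hx : x ^ (p + 1) = 0) (hy : y ^ (q + 1) = 0) (m i j : ℕ) (h : p + q < i + j + m) :
    x ^ i * y ^ j * (x + y) ^ m = 0 := by
  induction m generalizing i j with
  | zero =>
    rcases (by omega : p + 1 ≤ i ∨ q + 1 ≤ j) with hi | hj
    · simp [pow_eq_zero_of_le hi hx]
    · simp [pow_eq_zero_of_le hj hy]
  | succ m ih =>
    linear_combination ih (i + 1) j (by omega) + ih i (j + 1) (by omega)

theorem pow_mul_pow_mul_add_pow_eq_rchoose_smul {R : Type*} [CommRing R] [Algebra ℝ R]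
    {x y : R} {p q : ℕ} (hx : x ^ (p + 1) = 0) (hy : y ^ (q + 1) = 0) (m i j : ℕ)
    (h : i + j + m = p + q) :
    x ^ i * y ^ j * (x + y) ^ m = rchoose m ((q : ℤ) - j) • (x ^ p * y ^ q) := by
  induction m generalizing i j with
  | zero =>
    rw [rchoose_zero]
    rcases lt_trichotomy j q with hj | rfl | hj
    · rw [if_neg (by omega), pow_eq_zero_of_le (by omega : p + 1 ≤ i) hx]
      simp
    · obtain rfl : i = p := by omega
      simp
    · rw [if_neg (by omega), pow_eq_zero_of_le (by omega : q + 1 ≤ j) hy]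
      simp
  | succ m ih =>
    have hi := ih (i + 1) j (by omega)
    have hj := ih i (j + 1) (by omega)
    rw [Nat.cast_succ, ← sub_sub] at hj
    rw [rchoose_succ, add_smul]
    linear_combination hi + hj

theorem add_pow_succ_of_sq_eq_zero {R : Type*} [CommRing R] {e : R} (he : e ^ 2 = 0)
    (s : R) (m : ℕ) : (s + e) ^ (m + 1) = s ^ (m + 1) + (m + 1) * e * s ^ m := by
  induction m with
  | zero => simp
  | succ m ih =>
    rw [pow_succ, ih]
    push_cast
    linear_combination (m + 1) * s ^ m * he

theorem stmt3 {R : Type*} [CommRing R] [Algebra ℝ R]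
    (n₁ n₂ : ℕ) (h₁ : 1 ≤ n₁) (h₂ : 1 ≤ n₂) (a b t : ℝ)
    (φ₁ φ₂ η : R) (hφ₁ : φ₁ ^ (n₁ + 1) = 0) (hφ₂ : φ₂ ^ (n₂ + 1) = 0)
    (hη : η ^ 2 = 0) :
    (φ₁ ^ 2 + (2 * a) • (φ₁ * φ₂) + (a ^ 2 + b ^ 2) • φ₂ ^ 2) *
        (φ₁ + φ₂ + t • η) ^ (n₁ + n₂ + 1 - 2) =
      ((((n₁ + n₂ + 1 : ℕ) : ℝ) - 2) * t *
          (rchoose (n₁ + n₂ + 1 - 3) (n₂ : ℤ)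
            + 2 * a * rchoose (n₁ + n₂ + 1 - 3) ((n₂ : ℤ) - 1)
            + (a ^ 2 + b ^ 2) * rchoose (n₁ + n₂ + 1 - 3) ((n₂ : ℤ) - 2))) •
        (φ₁ ^ n₁ * φ₂ ^ n₂ * η) := by
  obtain ⟨m, hm⟩ : ∃ m, n₁ + n₂ = m + 2 := ⟨n₁ + n₂ - 2, by omega⟩
  have hm₂ : n₁ + n₂ + 1 - 2 = m + 1 := by omega
  have hm₃ : n₁ + n₂ + 1 - 3 = m := by omega
  have hcast : ((n₁ + n₂ + 1 : ℕ) : ℝ) - 2 = m + 1 := by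
    rw [hm]
    push_cast
    ring
  have he : (t • η) ^ 2 = 0 := by rw [smul_pow, hη, smul_zero]
  rw [hm₂, hm₃, hcast, add_pow_succ_of_sq_eq_zero he]
  have z₁ := pow_mul_pow_mul_add_pow_eq_zero hφ₁ hφ₂ (m + 1) 2 0 (by omega)
  have z₂ := pow_mul_pow_mul_add_pow_eq_zero hφ₁ hφ₂ (m + 1) 1 1 (by omega)
  have z₃ := pow_mul_pow_mul_add_pow_eq_zero hφ₁ hφ₂ (m + 1) 0 2 (by omega)
  have c₁ := pow_mul_pow_mul_add_pow_eq_rchoose_smul hφ₁ hφ₂ m 2 0 (by omega)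
  have c₂ := pow_mul_pow_mul_add_pow_eq_rchoose_smul hφ₁ hφ₂ m 1 1 (by omega)
  have c₃ := pow_mul_pow_mul_add_pow_eq_rchoose_smul hφ₁ hφ₂ m 0 2 (by omega)
  simp only [Nat.cast_zero, Nat.cast_one, Nat.cast_ofNat, sub_zero] at c₁ c₂ c₃
  simp only [Algebra.smul_def, map_add, map_mul, map_natCast, map_one] at c₁ c₂ c₃ ⊢
  linear_combination
    z₁ + algebraMap ℝ R 2 * algebraMap ℝ R a * z₂ + algebraMap ℝ R (a ^ 2) * z₃
      + algebraMap ℝ R (b ^ 2) * z₃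
      + (m + 1) * algebraMap ℝ R t * η * (c₁ + algebraMap ℝ R 2 * algebraMap ℝ R a * c₂
        + (algebraMap ℝ R (a ^ 2) + algebraMap ℝ R (b ^ 2)) * c₃)
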